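/- arXiv:2312.11783 — 3 statements merged into one kernel-verified Lean document; each statement's English description precedes it below -/
import Mathlib

section
/- Let n ≥ 1, let φ₀, φ₁ ∈ ℝⁿ be phase vectors, let ω ∈ ℝ, and for each coordinate k define Z₀,ₖ(t) = exp(i(ωt + φ₀,ₖ)) and Z₁,ₖ(t) = exp(i(ωt + φ₁,ₖ)). Then for every real t, (1/n) · Σ_{k=1}^n cos(2 · arccos(‖Z₀,ₖ(t) + Z₁,ₖ(t)‖ / 2)) = similarity(φ₀, φ₁). That is, the FHRR similarity between two phase vectors can be computed at any instant from the superposition of the corresponding pairs of frequency-locked oscillators. -/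
open Complex

theorem norm_exp_I_mul_add_exp_I_mul_sq (a b : ℝ) :
    ‖Complex.exp (Complex.I * a) + Complex.exp (Complex.I * b)‖ ^ 2 =
      2 + 2 * Real.cos (a - b) := by
  rw [mul_comm Complex.I, mul_comm Complex.I, Complex.sq_norm, Complex.normSq_apply,
    Complex.add_re, Complex.add_im, Complex.exp_ofReal_mul_I_re, Complex.exp_ofReal_mul_I_re,
    Complex.exp_ofReal_mul_I_im, Complex.exp_ofReal_mul_I_im, Real.cos_sub]
  linear_combination Real.sin_sq_add_cos_sq a + Real.sin_sq_add_cos_sq b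

theorem cos_two_mul_arccos_half_norm_exp_add_exp (a b : ℝ) :
    Real.cos (2 * Real.arccos
        (‖Complex.exp (Complex.I * a) + Complex.exp (Complex.I * b)‖ / 2)) =
      Real.cos (a - b) := by
  have hsq := norm_exp_I_mul_add_exp_I_mul_sq a b
  have h0 := norm_nonneg (Complex.exp (Complex.I * a) + Complex.exp (Complex.I * b))
  have h1 := Real.cos_le_one (a - b)
  rw [Real.cos_two_mul, Real.cos_arccos (by linarith) (by nlinarith)]
  linear_combination hsq / 2

/-- The FHRR similarity `(1/n) Σₖ cos(φ₀,ₖ − φ₁,ₖ)` between two phase vectors can be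
computed at any instant `t` from the superposition of the corresponding pairs of
frequency-locked oscillator states. -/
theorem similarity_via_oscillator_superposition (n : ℕ) (hn : 1 ≤ n)
    (φ₀ φ₁ : Fin n → ℝ) (ω t : ℝ) :
    (1 / n : ℝ) * ∑ k, Real.cos (2 * Real.arccos
        (‖Complex.exp (Complex.I * (ω * t + φ₀ k)) +
            Complex.exp (Complex.I * (ω * t + φ₁ k))‖ / 2)) =
      (1 / n : ℝ) * ∑ k, Real.cos (φ₀ k - φ₁ k) := by
  congr 1
  refine Finset.sum_congr rfl fun k _ => ?_
  have h := cos_two_mul_arccos_half_norm_exp_add_exp (ω * t + φ₀ k) (ω * t + φ₁ k)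
  rw [add_sub_add_left_eq_sub] at h
  exact_mod_cast h
end

section
/- Let m ≥ 1 and let φ₁, …, φ_m ∈ ℝⁿ be phase vectors such that for each coordinate k the sum Sₖ = Σ_{j=1}^m exp(i φ_{j,k}) is nonzero. Then for every phase vector ψ ∈ ℝⁿ, Σ_{j=1}^m similarity(ψ, φ_j) ≤ (1/n) · Σ_{k=1}^n ‖Sₖ‖, and equality holds when ψₖ = arg(Sₖ) for every k. That is, the bundling output, whose k-th phase is the argument of the coordinatewise complex sum of the inputs, maximizes the total similarity to the input symbols over all phase vectors. -/
open Complex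

/-- The FHRR similarity of two phase vectors. -/
noncomputable def similarity {n : ℕ} (φ₀ φ₁ : Fin n → ℝ) : ℝ :=
  (1 / n : ℝ) * ∑ k, Real.cos (φ₀ k - φ₁ k)

/-- A sum of cosines of phase differences is a single cosine, with amplitude and phase given by
the complex sum of the phases. -/
theorem sum_cos_sub_eq_norm_mul_cos_sub_arg {ι : Type*} (s : Finset ι) (θ : ι → ℝ) (x : ℝ) :
    ∑ j ∈ s, Real.cos (x - θ j) =
      ‖∑ j ∈ s, Complex.exp (Complex.I * θ j)‖ *
        Real.cos (x - (∑ j ∈ s, Complex.exp (Complex.I * θ j)).arg) := by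
  set S := ∑ j ∈ s, Complex.exp (Complex.I * θ j) with hS
  have hre : S.re = ∑ j ∈ s, Real.cos (θ j) := by
    simp [hS, mul_comm Complex.I, Complex.exp_ofReal_mul_I_re]
  have him : S.im = ∑ j ∈ s, Real.sin (θ j) := by
    simp [hS, mul_comm Complex.I, Complex.exp_ofReal_mul_I_im]
  simp only [Real.cos_sub, Finset.sum_add_distrib, ← Finset.mul_sum, ← hre, ← him]
  rw [← Complex.norm_mul_cos_arg S, ← Complex.norm_mul_sin_arg S]
  ring

/-- The total similarity of a phase vector to a family, in terms of the coordinatewise complex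
sums of the family. -/
theorem sum_similarity_eq {ι : Type*} {n : ℕ} (s : Finset ι) (φ : ι → Fin n → ℝ)
    (ψ : Fin n → ℝ) :
    ∑ j ∈ s, similarity ψ (φ j) =
      (1 / n : ℝ) * ∑ k, ‖∑ j ∈ s, Complex.exp (Complex.I * φ j k)‖ *
        Real.cos (ψ k - (∑ j ∈ s, Complex.exp (Complex.I * φ j k)).arg) := by
  simp only [similarity, ← Finset.mul_sum]
  rw [Finset.sum_comm]
  simp only [sum_cos_sub_eq_norm_mul_cos_sub_arg s (fun j => φ j _)]

/-- Bundling maximizes total similarity: for phase vectors `φ₁, …, φ_m` whose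
coordinatewise complex sums `Sₖ = Σⱼ exp(i φ_{j,k})` are nonzero, every phase vector `ψ`
satisfies `Σⱼ sim(ψ, φⱼ) ≤ (1/n) Σₖ ‖Sₖ‖`, with equality when `ψₖ = arg Sₖ`. -/
theorem bundling_maximizes_similarity (n m : ℕ) (hm : 1 ≤ m) (φ : Fin m → Fin n → ℝ)
    (hS : ∀ k, (∑ j, Complex.exp (Complex.I * φ j k)) ≠ 0) :
    (∀ ψ : Fin n → ℝ,
      ∑ j, similarity ψ (φ j) ≤
        (1 / n : ℝ) * ∑ k, ‖∑ j, Complex.exp (Complex.I * φ j k)‖) ∧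
    (∑ j, similarity (fun k => (∑ j', Complex.exp (Complex.I * φ j' k)).arg) (φ j) =
      (1 / n : ℝ) * ∑ k, ‖∑ j, Complex.exp (Complex.I * φ j k)‖) := by
  refine ⟨fun ψ => ?_, ?_⟩
  · rw [sum_similarity_eq]
    gcongr with k
    exact mul_le_of_le_one_right (norm_nonneg _) (Real.cos_le_one _)
  · simp [sum_similarity_eq]
end

section
/- Let ω, φ₀, φ₁ be real numbers, define Z₀(t) = exp(i(ωt + φ₀)), Z₁(t) = exp(i(ωt + φ₁)), Z_ref(t) = exp(iωt), and let B(t) = Z₀(t) + Z₀(t) · (Z₁(t) − Z_ref(t)) · conj(Z_ref(t)) be the oscillator-based binding of Z₀ and Z₁. Then for every real t, B(t) + B(t) · conj(Z₁(t) − Z_ref(t)) · Z_ref(t) = Z₀(t). That is, the oscillator-based unbinding operation exactly inverts the oscillator-based binding operation. -/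
open Complex

/-- The oscillator-based unbinding operation exactly inverts the oscillator-based binding
operation: with `B(t) = Z₀ + Z₀ · (Z₁ − Z_ref) · conj(Z_ref)` the oscillator-based binding
of `Z₀` and `Z₁`, we have `B + B · conj(Z₁ − Z_ref) · Z_ref = Z₀` for all `t`. -/
theorem unbind_inverts_bind_via_oscillators (ω φ₀ φ₁ : ℝ)
    (Z₀ Z₁ Zref B : ℝ → ℂ)
    (hZ₀ : ∀ t, Z₀ t = Complex.exp (Complex.I * (ω * t + φ₀)))
    (hZ₁ : ∀ t, Z₁ t = Complex.exp (Complex.I * (ω * t + φ₁)))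
    (hZref : ∀ t, Zref t = Complex.exp (Complex.I * (ω * t)))
    (hB : ∀ t, B t = Z₀ t + Z₀ t * (Z₁ t - Zref t) * (starRingEnd ℂ) (Zref t)) :
    ∀ t : ℝ, B t + B t * (starRingEnd ℂ) (Z₁ t - Zref t) * Zref t = Z₀ t := by
  intro t
  have h₁ : Z₁ t * (starRingEnd ℂ) (Z₁ t) = 1 := by
    rw [hZ₁, mul_comm Complex.I, Complex.mul_conj']
    have h := Complex.norm_exp_ofReal_mul_I (ω * t + φ₁)
    push_cast at h
    simp [h]
  have href : Zref t * (starRingEnd ℂ) (Zref t) = 1 := by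
    rw [hZref, mul_comm Complex.I, Complex.mul_conj']
    have h := Complex.norm_exp_ofReal_mul_I (ω * t)
    push_cast at h
    simp [h]
  have hbind : B t = Z₀ t * Z₁ t * (starRingEnd ℂ) (Zref t) := by
    rw [hB]
    linear_combination -Z₀ t * href
  rw [hbind, map_sub]
  linear_combination Z₀ t * Zref t * (starRingEnd ℂ) (Zref t) * h₁
    + (Z₀ t - Z₀ t * Z₁ t * (starRingEnd ℂ) (Zref t)) * href
end
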